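/- arXiv:1211.1911 — 6 statements merged into one kernel-verified Lean document; each statement's English description precedes it below -/
import Mathlib

section
/- Let G be a finite group and H, K subgroups of G. Then β_{G/H}(K) = β_{G/H}(H) · #{gHg⁻¹ : g ∈ G, K ≤ gHg⁻¹}; that is, the mark of K on G/H equals the number of cosets of H fixed by H itself times the number of distinct conjugates of H that contain K. -/
/-- The conjugate subgroup `g H g⁻¹`. -/
def conjSub {G : Type*} [Group G] (g : G) (H : Subgroup G) : Subgroup G :=
  H.map (MulAut.conj g).toMonoidHom

/-- The mark `β_{G/H}(K)`: the number of left cosets in `G/H` fixed by every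
element of `K` under the left-multiplication action. -/
noncomputable def mark {G : Type*} [Group G] (H K : Subgroup G) : ℕ :=
  Nat.card {x : G ⧸ H // ∀ k ∈ K, k • x = x}

theorem stabilizer_mk_eq_conjSub {G : Type*} [Group G] (H : Subgroup G) (g : G) :
    MulAction.stabilizer G (g : G ⧸ H) = conjSub g H := by
  have h := MulAction.stabilizer_smul_eq_stabilizer_map_conj g ((1 : G) : G ⧸ H)
  rw [MulAction.stabilizer_quotient, MulAction.Quotient.smul_coe, smul_eq_mul, mul_one] at h
  exact h

theorem stabilizer_smul_eq_conjSub {G : Type*} [Group G] {H : Subgroup G} (g : G) {y : G ⧸ H}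
    (hy : MulAction.stabilizer G y = H) : MulAction.stabilizer G (g • y) = conjSub g H := by
  rw [MulAction.stabilizer_smul_eq_stabilizer_map_conj, hy, conjSub]

theorem conjSub_inv_conjSub {G : Type*} [Group G] (g : G) (H : Subgroup G) :
    conjSub g⁻¹ (conjSub g H) = H := by
  ext x
  simp [conjSub, Subgroup.mem_map, mul_assoc]

theorem le_stabilizer_iff_forall_smul_eq {G α : Type*} [Group G] [MulAction G α]
    (K : Subgroup G) (x : α) :
    K ≤ MulAction.stabilizer G x ↔ ∀ k ∈ K, k • x = x :=
  Iff.rfl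

/-- In a finite group, a coset fixed by `H` has stabilizer exactly `H`. -/
theorem stabilizer_eq_iff_forall_smul_eq {G : Type*} [Group G] [Finite G] (H : Subgroup G)
    (x : G ⧸ H) : MulAction.stabilizer G x = H ↔ ∀ h ∈ H, h • x = x := by
  rw [← le_stabilizer_iff_forall_smul_eq]
  refine ⟨fun h => h.ge, fun h => (Subgroup.eq_of_le_of_card_ge h ?_).symm⟩
  obtain ⟨g, rfl⟩ := QuotientGroup.mk_surjective x
  rw [stabilizer_mk_eq_conjSub]
  exact (Subgroup.card_map_of_injective (MulAut.conj g).injective).le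

theorem stmt3 {G : Type*} [Group G] [Finite G] (H K : Subgroup G) :
    mark H K =
      mark H H * Nat.card {L : Subgroup G // (∃ g : G, L = conjSub g H) ∧ K ≤ L} := by
  choose c hc using fun L : {L : Subgroup G // (∃ g : G, L = conjSub g H) ∧ K ≤ L} => L.2.1
  let f : {y : G ⧸ H // ∀ h ∈ H, h • y = y} ×
      {L : Subgroup G // (∃ g : G, L = conjSub g H) ∧ K ≤ L} →
      {x : G ⧸ H // ∀ k ∈ K, k • x = x} := fun p =>
    ⟨c p.2 • p.1.1, by
      rw [← le_stabilizer_iff_forall_smul_eq, stabilizer_smul_eq_conjSub _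
        ((stabilizer_eq_iff_forall_smul_eq H _).2 p.1.2), ← hc]
      exact p.2.2.2⟩
  have hf : Function.Bijective f := by
    constructor
    · rintro ⟨y, L⟩ ⟨y', L'⟩ h
      have h' : c L • y.1 = c L' • y'.1 := congrArg Subtype.val h
      have hL : L = L' := by
        have hs := congrArg (MulAction.stabilizer G) h'
        rw [stabilizer_smul_eq_conjSub _ ((stabilizer_eq_iff_forall_smul_eq H _).2 y.2),
          stabilizer_smul_eq_conjSub _ ((stabilizer_eq_iff_forall_smul_eq H _).2 y'.2),
          ← hc, ← hc] at hs
        exact Subtype.ext hs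
      subst hL
      exact Prod.ext (Subtype.ext (MulAction.injective _ h')) rfl
    · rintro ⟨x, hx⟩
      obtain ⟨g, hg⟩ := QuotientGroup.mk_surjective x
      let L : {L : Subgroup G // (∃ g : G, L = conjSub g H) ∧ K ≤ L} :=
        ⟨MulAction.stabilizer G x, ⟨g, hg ▸ stabilizer_mk_eq_conjSub H g⟩, hx⟩
      have hL : MulAction.stabilizer G x = conjSub (c L) H := hc L
      have hy : MulAction.stabilizer G ((c L)⁻¹ • x) = H := by
        rw [MulAction.stabilizer_smul_eq_stabilizer_map_conj, hL]
        exact conjSub_inv_conjSub _ _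
      exact ⟨(⟨(c L)⁻¹ • x, (stabilizer_eq_iff_forall_smul_eq H _).1 hy⟩, L),
        Subtype.ext (smul_inv_smul _ _)⟩
  rw [mark, mark, ← Nat.card_prod]
  exact (Nat.card_eq_of_bijective f hf).symm
end

section
/- Let G be a finite group and H, K subgroups of G. Then #{gHg⁻¹ : g ∈ G, gHg⁻¹ ≤ K} · β_{G/H}(H) · β_{G/K}(1) = β_{G/K}(H) · β_{G/H}(1); that is, the number of distinct conjugates of H contained in K equals β_{G/K}(H)·β_{G/H}(1) / (β_{G/H}(H)·β_{G/K}(1)). -/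
theorem conjSub_le_iff {G : Type*} [Group G] (g : G) (H K : Subgroup G) :
    conjSub g H ≤ K ↔ ∀ h ∈ H, g * h * g⁻¹ ∈ K := by
  simp [conjSub, SetLike.le_def]

theorem conjSub_mul {G : Type*} [Group G] (a b : G) (H : Subgroup G) :
    conjSub (a * b) H = conjSub a (conjSub b H) := by
  simp only [conjSub, Subgroup.map_map]
  congr 1
  ext x
  simp [mul_assoc]

theorem conjSub_one {G : Type*} [Group G] (H : Subgroup G) : conjSub 1 H = H := by
  ext x
  simp [conjSub]

theorem card_conjSub {G : Type*} [Group G] (g : G) (H : Subgroup G) :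
    Nat.card (conjSub g H) = Nat.card H :=
  Subgroup.card_map_of_injective (MulAut.conj g).injective

theorem conjSub_le_self_iff {G : Type*} [Group G] [Finite G] (g : G) (H : Subgroup G) :
    conjSub g H ≤ H ↔ conjSub g H = H :=
  ⟨fun h => Subgroup.eq_of_le_of_card_ge h (card_conjSub g H).ge, fun h => h.le⟩

theorem mark_bot {G : Type*} [Group G] (H : Subgroup G) : mark H ⊥ = H.index :=
  Nat.card_congr (Equiv.subtypeUnivEquiv fun x k hk => by
    rw [Subgroup.mem_bot.mp hk, one_smul])

/-- The elements conjugating `H` into `K` are counted by the cosets of `K` fixed by `H`. -/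
theorem card_conjSub_le {G : Type*} [Group G] (H K : Subgroup G) :
    Nat.card {g : G // conjSub g H ≤ K} = Nat.card K * mark K H := by
  have h := Nat.card_congr (QuotientGroup.preimageMkEquivSubgroupProdSet K
    {x : G ⧸ K | ∀ k ∈ H, k • x = x})
  rw [Nat.card_prod] at h
  refine Eq.trans (Nat.card_congr ((Equiv.inv G).subtypeEquiv fun g => ?_)) h
  rw [conjSub_le_iff]
  simp only [Set.mem_preimage, Set.mem_ofPred_eq, Equiv.inv_apply]
  refine ⟨fun hg k hk => ?_, fun hg k hk => ?_⟩
  · refine (QuotientGroup.eq.mpr ?_).symm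
    simpa [mul_assoc] using hg k hk
  · simpa [mul_assoc] using QuotientGroup.eq.mp (hg k hk).symm

/-- The elements conjugating `H` into `K` are counted by the conjugates of `H` in `K`, each of
which is attained on a coset of the normalizer of `H`. -/
theorem card_conjSub_le_eq_mul {G : Type*} [Group G] [Finite G] (H K : Subgroup G) :
    Nat.card {g : G // conjSub g H ≤ K} =
      Nat.card {L : Subgroup G // (∃ g : G, L = conjSub g H) ∧ L ≤ K} *
        Nat.card {g : G // conjSub g H ≤ H} := by
  rw [← Nat.card_prod]
  choose c hc using fun L : {L : Subgroup G // (∃ g : G, L = conjSub g H) ∧ L ≤ K} => L.2.1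
  refine Nat.card_congr
    { toFun := fun g => (⟨conjSub g.1 H, ⟨g.1, rfl⟩, g.2⟩,
        ⟨(c ⟨conjSub g.1 H, ⟨g.1, rfl⟩, g.2⟩)⁻¹ * g.1, ?_⟩)
      invFun := fun p => ⟨c p.1 * p.2.1, ?_⟩
      left_inv := fun g => by simp
      right_inv := ?_ }
  · have h := hc ⟨conjSub g.1 H, ⟨g.1, rfl⟩, g.2⟩
    dsimp only at h
    generalize c _ = a at h ⊢
    rw [conjSub_mul, h, ← conjSub_mul, inv_mul_cancel, conjSub_one]
  · rw [conjSub_mul, (conjSub_le_self_iff _ _).mp p.2.2, ← hc]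
    exact p.1.2.2
  · rintro ⟨L, n, hn⟩
    have h : conjSub (c L * n) H = L.1 := by
      rw [conjSub_mul, (conjSub_le_self_iff _ _).mp hn, ← hc]
    have hL : (⟨conjSub (c L * n) H, ⟨_, rfl⟩, h.trans_le L.2.2⟩ :
        {L : Subgroup G // (∃ g : G, L = conjSub g H) ∧ L ≤ K}) = L := Subtype.ext h
    refine Prod.ext hL (Subtype.ext ?_)
    simp [hL]

theorem stmt6 {G : Type*} [Group G] [Finite G] (H K : Subgroup G) :
    Nat.card {L : Subgroup G // (∃ g : G, L = conjSub g H) ∧ L ≤ K} *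
      (mark H H * mark K ⊥) = mark K H * mark H ⊥ := by
  have h := card_conjSub_le_eq_mul H K
  rw [card_conjSub_le, card_conjSub_le] at h
  rw [mark_bot, mark_bot]
  have hH := H.card_mul_index
  have hK := K.card_mul_index
  refine Nat.eq_of_mul_eq_mul_left (Nat.mul_pos (Nat.card_pos (α := H))
    (Nat.card_pos (α := K))) ?_
  calc _ = (Nat.card {L : Subgroup G // (∃ g : G, L = conjSub g H) ∧ L ≤ K} *
        (Nat.card H * mark H H)) * (Nat.card K * K.index) := by ring
    _ = (Nat.card K * mark K H) * (Nat.card H * H.index) := by rw [← h, hK, hH]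
    _ = _ := by ring
end

section
/- Let X be a finite set and H a subgroup of the symmetric group Sym(X). Call a partition P of X H-admissible if every block of P is H-invariant and, for every σ ∈ H and every block Y of P, the permutation that agrees with σ on Y and is the identity on X \ Y also belongs to H. Then the common refinement of any two H-admissible partitions of X is again H-admissible; consequently there exists a finest H-admissible partition of X. -/
/-- A partition `P` of the underlying set is `H`-admissible: it is a partition,
every block is `H`-invariant, and for every `σ ∈ H` and every block `Y`, the
permutation agreeing with `σ` on `Y` and with the identity off `Y` also lies in `H`. -/
def IsAdmissible {α : Type*} (H : Subgroup (Equiv.Perm α)) (P : Set (Set α)) : Prop :=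
  Setoid.IsPartition P ∧
  (∀ σ ∈ H, ∀ Y ∈ P, σ '' Y = Y) ∧
  (∀ σ ∈ H, ∀ Y ∈ P, ∃ τ ∈ H, (∀ x ∈ Y, τ x = σ x) ∧ ∀ x ∉ Y, τ x = x)

theorem Setoid.IsPartition.inter {α : Type*} {P₁ P₂ : Set (Set α)} (h₁ : Setoid.IsPartition P₁)
    (h₂ : Setoid.IsPartition P₂) :
    Setoid.IsPartition {S : Set α | S.Nonempty ∧ ∃ A ∈ P₁, ∃ B ∈ P₂, S = A ∩ B} := by
  refine ⟨fun h => Set.not_nonempty_empty h.1, fun x => ?_⟩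
  obtain ⟨A, ⟨hA, hxA⟩, hA'⟩ := h₁.2 x
  obtain ⟨B, ⟨hB, hxB⟩, hB'⟩ := h₂.2 x
  refine ⟨A ∩ B, ⟨⟨⟨x, hxA, hxB⟩, A, hA, B, hB, rfl⟩, hxA, hxB⟩, ?_⟩
  rintro _ ⟨⟨-, C, hC, D, hD, rfl⟩, hxC, hxD⟩
  rw [hA' C ⟨hC, hxC⟩, hB' D ⟨hD, hxD⟩]

namespace IsAdmissible

variable {α : Type*} {H : Subgroup (Equiv.Perm α)}

theorem inter {P₁ P₂ : Set (Set α)} (h₁ : IsAdmissible H P₁) (h₂ : IsAdmissible H P₂) :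
    IsAdmissible H {S : Set α | S.Nonempty ∧ ∃ A ∈ P₁, ∃ B ∈ P₂, S = A ∩ B} := by
  refine ⟨h₁.1.inter h₂.1, ?_, ?_⟩
  · rintro σ hσ _ ⟨-, A, hA, B, hB, rfl⟩
    rw [Set.image_inter σ.injective, h₁.2.1 σ hσ A hA, h₂.2.1 σ hσ B hB]
  · rintro σ hσ _ ⟨-, A, hA, B, hB, rfl⟩
    obtain ⟨τ, hτ, hτA, hτA'⟩ := h₁.2.2 σ hσ A hA
    obtain ⟨ρ, hρ, hρB, hρB'⟩ := h₂.2.2 τ hτ B hB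
    refine ⟨ρ, hρ, fun x hx => (hρB x hx.2).trans (hτA x hx.1), fun x hx => ?_⟩
    by_cases hxB : x ∈ B
    · exact (hρB x hxB).trans (hτA' x fun hxA => hx ⟨hxA, hxB⟩)
    · exact hρB' x hxB

/-- The partition with at most one block is admissible; it has no block when `α` is empty. -/
theorem indiscrete (H : Subgroup (Equiv.Perm α)) :
    IsAdmissible H {S : Set α | S.Nonempty ∧ S = Set.univ} := by
  refine ⟨⟨fun h => Set.not_nonempty_empty h.1, fun x =>
    ⟨Set.univ, ⟨⟨⟨x, trivial⟩, rfl⟩, trivial⟩, fun _ h => h.1.2⟩⟩, ?_, ?_⟩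
  · rintro σ - _ ⟨-, rfl⟩
    exact Set.image_univ_of_surjective σ.surjective
  · rintro σ hσ _ ⟨-, rfl⟩
    exact ⟨σ, hσ, fun _ _ => rfl, fun x hx => (hx trivial).elim⟩

theorem exists_refinement_of_finite {F : Set (Set (Set α))} (hF : F.Finite)
    (hadm : ∀ Q ∈ F, IsAdmissible H Q) :
    ∃ P : Set (Set α), IsAdmissible H P ∧ ∀ Q ∈ F, ∀ S ∈ P, ∃ T ∈ Q, S ⊆ T := by
  induction F, hF using Set.Finite.induction_on with
  | empty => exact ⟨_, indiscrete H, fun _ h => h.elim⟩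
  | @insert Q F _ _ ih =>
    obtain ⟨P, hP, hPF⟩ := ih fun R hR => hadm R (Set.mem_insert_of_mem Q hR)
    refine ⟨_, (hadm Q (Set.mem_insert Q F)).inter hP, ?_⟩
    rintro R hR _ ⟨-, A, hA, B, hB, rfl⟩
    obtain rfl | hR := hR
    · exact ⟨A, hA, Set.inter_subset_left⟩
    · obtain ⟨T, hT, hBT⟩ := hPF R hR B hB
      exact ⟨T, hT, Set.inter_subset_right.trans hBT⟩

end IsAdmissible

theorem stmt12 {α : Type*} [Finite α] (H : Subgroup (Equiv.Perm α)) :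
    (∀ P₁ P₂ : Set (Set α), IsAdmissible H P₁ → IsAdmissible H P₂ →
      IsAdmissible H {S : Set α | S.Nonempty ∧ ∃ A ∈ P₁, ∃ B ∈ P₂, S = A ∩ B}) ∧
    ∃ P : Set (Set α), IsAdmissible H P ∧
      ∀ Q : Set (Set α), IsAdmissible H Q → ∀ S ∈ P, ∃ T ∈ Q, S ⊆ T := by
  exact ⟨fun _ _ h₁ h₂ => h₁.inter h₂,
    IsAdmissible.exists_refinement_of_finite (Set.toFinite {Q | IsAdmissible H Q}) fun _ h => h⟩
end

section
/- Let α be a finite type and let a, b be nontrivial permutations of α with disjoint supports whose orders x₁ and x₂ satisfy gcd(x₁, x₂) > 1. Then a does not belong to the cyclic subgroup generated by a·b. -/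
theorem stmt15 {α : Type*} [Finite α] (a b : Equiv.Perm α) (ha : a ≠ 1) (hb : b ≠ 1)
    (hdisj : a.Disjoint b) (hgcd : 1 < Nat.gcd (orderOf a) (orderOf b)) :
    a ∉ Subgroup.zpowers (a * b) := by
  rintro ⟨k, hk⟩
  have hmul : a ^ (k - 1) * b ^ k = 1 := by
    have hk' : a ^ k * b ^ k = a := by rw [← hdisj.commute.mul_zpow]; exact hk
    rw [zpow_sub_one, (Commute.zpow_self a k).inv_right.eq, mul_assoc, hk', inv_mul_cancel]
  obtain ⟨h₁, h₂⟩ := (hdisj.zpow_disjoint_zpow (k - 1) k).mul_eq_one_iff.mp hmul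
  have hdvd : ((Nat.gcd (orderOf a) (orderOf b) : ℕ) : ℤ) ∣ k - (k - 1) :=
    dvd_sub
      ((Int.natCast_dvd_natCast.mpr (Nat.gcd_dvd_right _ _)).trans
        (orderOf_dvd_iff_zpow_eq_one.mpr h₂))
      ((Int.natCast_dvd_natCast.mpr (Nat.gcd_dvd_left _ _)).trans
        (orderOf_dvd_iff_zpow_eq_one.mpr h₁))
  rw [sub_sub_cancel] at hdvd
  exact hgcd.ne' (Nat.dvd_one.mp (by exact_mod_cast hdvd))
end

section
/- For every n ≥ 1, the number of conjugacy classes of cyclic subgroups of the symmetric group Sym(Fin n) equals the number of partitions of n. -/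
theorem conjSub_zpowers {G : Type*} [Group G] (g x : G) :
    conjSub g (Subgroup.zpowers x) = Subgroup.zpowers (g * x * g⁻¹) :=
  MonoidHom.map_zpowers _ x

theorem exists_coprime_pow_eq_of_zpowers_eq {G : Type*} [Group G] [Finite G] {x y : G}
    (h : Subgroup.zpowers x = Subgroup.zpowers y) :
    ∃ k : ℕ, k.Coprime (orderOf x) ∧ x ^ k = y := by
  have hy : y ∈ Subgroup.zpowers x := h ▸ Subgroup.mem_zpowers y
  obtain ⟨k, rfl⟩ := mem_powers_iff_mem_zpowers.2 hy
  refine ⟨k, ?_, rfl⟩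
  have hord : orderOf x = orderOf (x ^ k) := by
    rw [← Nat.card_zpowers, ← Nat.card_zpowers]
    exact congrArg (fun H : Subgroup G => Nat.card H) h
  rw [orderOf_pow] at hord
  have hpos := orderOf_pos x
  rcases Nat.div_eq_self.1 hord.symm with h0 | h1
  · exact absurd h0 hpos.ne'
  · exact Nat.Coprime.symm h1

namespace Equiv.Perm

variable {α : Type*} [Fintype α] [DecidableEq α]

theorem cycleType_pow_of_coprime (σ : Perm α) {k : ℕ} (hk : k.Coprime (orderOf σ)) :
    (σ ^ k).cycleType = σ.cycleType := by
  induction σ using cycle_induction_on with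
  | base_one => simp
  | base_cycles σ hσ =>
    rw [hσ.cycleType, (hσ.pow_iff.2 hk).cycleType, support_pow_coprime hk]
  | induction_disjoint σ τ hd _ hσ hτ =>
    rw [hd.orderOf] at hk
    rw [hd.commute.mul_pow, (hd.pow_disjoint_pow k k).cycleType_mul, hd.cycleType_mul,
      hσ (hk.coprime_dvd_right (Nat.dvd_lcm_left _ _)),
      hτ (hk.coprime_dvd_right (Nat.dvd_lcm_right _ _))]

theorem isConj_of_zpowers_eq {σ τ : Perm α}
    (h : Subgroup.zpowers σ = Subgroup.zpowers τ) : IsConj σ τ := by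
  obtain ⟨k, hk, rfl⟩ := exists_coprime_pow_eq_of_zpowers_eq h
  exact isConj_iff_cycleType_eq.2 (cycleType_pow_of_coprime σ hk).symm

theorem exists_zpowers_eq_conjSub_iff_isConj {σ τ : Perm α} :
    (∃ g, Subgroup.zpowers τ = conjSub g (Subgroup.zpowers σ)) ↔ IsConj σ τ := by
  simp only [conjSub_zpowers]
  constructor
  · rintro ⟨g, hg⟩
    exact (isConj_iff.2 ⟨g, rfl⟩).trans (isConj_of_zpowers_eq hg.symm)
  · intro h
    obtain ⟨g, rfl⟩ := isConj_iff.1 h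
    exact ⟨g, rfl⟩

theorem partition_surjective :
    Function.Surjective (partition : Perm α → (Fintype.card α).Partition) := by
  intro p
  have hones : p.parts.filter (fun a => ¬2 ≤ a) =
      Multiset.replicate (p.parts.filter (fun a => ¬2 ≤ a)).card 1 :=
    Multiset.eq_replicate_card.2 fun a ha => by
      obtain ⟨hmem, hlt⟩ := Multiset.mem_filter.1 ha
      have := p.parts_pos hmem
      omega
  have hparts := Multiset.filter_add_not (fun a => 2 ≤ a) p.parts
  have hsum : (p.parts.filter (fun a => 2 ≤ a)).sum +
      (p.parts.filter (fun a => ¬2 ≤ a)).card = Fintype.card α := by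
    have h := congrArg Multiset.sum hparts
    rw [Multiset.sum_add, p.parts_sum, hones, Multiset.sum_replicate, smul_eq_mul, mul_one] at h
    exact h
  obtain ⟨σ, hσ⟩ := (exists_with_cycleType_iff α (m := p.parts.filter (fun a => 2 ≤ a))).2
    ⟨by omega, fun a ha => (Multiset.mem_filter.1 ha).2⟩
  refine ⟨σ, Nat.Partition.ext ?_⟩
  have hcard : Fintype.card α - σ.support.card = (p.parts.filter (fun a => ¬2 ≤ a)).card := by
    rw [← sum_cycleType, hσ]
    omega
  rw [parts_partition, hσ, hcard, ← hones, hparts]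

theorem card_quot_conjSub_cyclic_eq_card_partition :
    Nat.card (Quot (fun (H K : {H : Subgroup (Perm α) // IsCyclic ↥H}) =>
      ∃ g, K.1 = conjSub g H.1)) = Nat.card (Fintype.card α).Partition := by
  have hgen (H : {H : Subgroup (Perm α) // IsCyclic ↥H}) :
      ∃ σ : Perm α, Subgroup.zpowers σ = H.1 :=
    (Subgroup.isCyclic_iff_exists_zpowers_eq_top H.1).1 H.2
  choose gen hgen using hgen
  have hrel (H K : {H : Subgroup (Perm α) // IsCyclic ↥H}) :
      (∃ g, K.1 = conjSub g H.1) ↔ (gen H).partition = (gen K).partition := by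
    rw [← hgen H, ← hgen K, exists_zpowers_eq_conjSub_iff_isConj, partition_eq_of_isConj]
  refine Nat.card_eq_of_bijective
    (Quot.lift (fun H => (gen H).partition) fun H K h => (hrel H K).1 h) ⟨?_, ?_⟩
  · rintro ⟨H⟩ ⟨K⟩ h
    exact Quot.sound ((hrel H K).2 h)
  · intro p
    obtain ⟨σ, rfl⟩ := partition_surjective p
    let H : {H : Subgroup (Perm α) // IsCyclic ↥H} := ⟨Subgroup.zpowers σ, inferInstance⟩
    exact ⟨Quot.mk _ H, partition_eq_of_isConj.1 (isConj_of_zpowers_eq (hgen H))⟩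

end Equiv.Perm

theorem stmt16 (n : ℕ) (hn : 1 ≤ n) :
    Nat.card (Quot (fun (H K : {H : Subgroup (Equiv.Perm (Fin n)) // IsCyclic ↥H}) =>
      ∃ g, K.1 = conjSub g H.1)) =
    Nat.card (Nat.Partition n) := by
  rw [Equiv.Perm.card_quot_conjSub_cyclic_eq_card_partition, Fintype.card_fin]
end

section
/- For every n ≥ 1, the number of conjugacy classes of subgroups of the symmetric group Sym(Fin n) equals the sum, over all partitions λ = 1^{a₁} 2^{a₂} ⋯ n^{a_n} of n, of ∏_{i=1}^{n} ((conn_i multichoose a_i)), where conn_i denotes the number of conjugacy classes of connected subgroups of Sym(Fin i) and ((c multichoose a)) = C(c + a − 1, a) is the number of a-element multisets chosen from a set of c objects. -/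
/-- A subgroup of `Sym(X)` is connected if the only `H`-admissible partition of `X`
is the one-block partition `{X}`. -/
def IsConnectedSubgroup {α : Type*} (H : Subgroup (Equiv.Perm α)) : Prop :=
  ∀ P : Set (Set α), IsAdmissible H P → P = {Set.univ}

/-- The number of conjugacy classes of connected subgroups of `Sym(Fin i)`. -/
noncomputable def conn (i : ℕ) : ℕ :=
  Nat.card (Quot (fun (H K : {H : Subgroup (Equiv.Perm (Fin i)) // IsConnectedSubgroup H}) =>
    ∃ g, K.1 = conjSub g H.1))

namespace PermIsoClasses

open Equiv

/-- Two permutation groups are isomorphic if some bijection of the underlying sets carries one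
to the other. -/
def PermIso {X Y : Type*} (H : Subgroup (Perm X)) (K : Subgroup (Perm Y)) : Prop :=
  ∃ e : X ≃ Y, ∀ (σ : Perm X) (τ : Perm Y), (∀ x, e (σ x) = τ (e x)) → (σ ∈ H ↔ τ ∈ K)

/-- A set `S` is `H`-split if it is `H`-invariant and `H` contains the restrictions to `S` of all
its elements. -/
def IsSplit {X : Type*} (H : Subgroup (Perm X)) (S : Set X) : Prop :=
  ∀ σ ∈ H, (∀ x, σ x ∈ S ↔ x ∈ S) ∧ ∃ τ ∈ H, (∀ x ∈ S, τ x = σ x) ∧ ∀ x ∉ S, τ x = x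

/-- The direct product of a family of permutation groups, acting on the disjoint union. -/
def prodSub {ι : Type*} {X : ι → Type*} (G : ∀ j, Subgroup (Perm (X j))) :
    Subgroup (Perm (Σ j, X j)) :=
  (Subgroup.pi Set.univ G).map (Perm.sigmaCongrRightHom X)

section PermIso

variable {X Y Z : Type*} {H : Subgroup (Perm X)} {K : Subgroup (Perm Y)} {L : Subgroup (Perm Z)}

theorem PermIso.refl (H : Subgroup (Perm X)) : PermIso H H := by
  refine ⟨Equiv.refl X, fun σ τ h => ?_⟩
  have : σ = τ := Equiv.ext h
  rw [this]

theorem PermIso.symm (h : PermIso H K) : PermIso K H := by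
  obtain ⟨e, he⟩ := h
  refine ⟨e.symm, fun σ τ h => (he τ σ fun x => ?_).symm⟩
  have := h (e x)
  rw [e.symm_apply_apply] at this
  rw [← this, e.apply_symm_apply]

theorem PermIso.trans (h : PermIso H K) (h' : PermIso K L) : PermIso H L := by
  obtain ⟨e, he⟩ := h
  obtain ⟨e', he'⟩ := h'
  refine ⟨e.trans e', fun σ τ h => ?_⟩
  rw [he σ (e.permCongr σ) (by simp), he' (e.permCongr σ) τ]
  intro y
  obtain ⟨x, rfl⟩ := e.surjective y
  simpa using h x

theorem permIso_map (H : Subgroup (Perm X)) (e : X ≃ Y) :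
    PermIso H (H.map e.permCongrHom.toMonoidHom) := by
  refine ⟨e, fun σ τ h => ?_⟩
  have : τ = e.permCongrHom σ := by
    ext y
    obtain ⟨x, rfl⟩ := e.surjective y
    simp [h]
  subst this
  exact (Subgroup.mem_map_iff_mem e.permCongrHom.injective).symm

theorem permIso_iff_conjSub {H K : Subgroup (Perm X)} : PermIso H K ↔ ∃ g, K = conjSub g H := by
  constructor
  · rintro ⟨e, he⟩
    refine ⟨e, ?_⟩
    ext τ
    have h₁ := he (e⁻¹ * τ * e) τ (by simp)
    rw [← h₁, conjSub, Subgroup.mem_map]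
    constructor
    · intro h
      exact ⟨_, h, by simp [mul_assoc]⟩
    · rintro ⟨σ, hσ, rfl⟩
      simpa [mul_assoc] using hσ
  · rintro ⟨g, rfl⟩
    refine ⟨g, fun σ τ h => ?_⟩
    have : τ = MulAut.conj g σ := by
      ext y
      obtain ⟨x, rfl⟩ := g.surjective y
      simp [h]
    subst this
    exact (Subgroup.mem_map_iff_mem (MulAut.conj g).injective).symm

theorem equivalence_conjSub :
    Equivalence fun H K : Subgroup (Perm X) => ∃ g, K = conjSub g H := by
  simp only [← permIso_iff_conjSub]
  exact ⟨PermIso.refl, PermIso.symm, PermIso.trans⟩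

theorem PermIso.natCard_eq (h : PermIso H K) : Nat.card X = Nat.card Y :=
  Nat.card_congr h.choose

end PermIso

section IsSplit

variable {X Y : Type*} {H : Subgroup (Perm X)} {K : Subgroup (Perm Y)}

theorem isSplit_univ : IsSplit H Set.univ :=
  fun σ hσ => ⟨by simp, σ, hσ, by simp, by simp⟩

theorem IsSplit.compl {S : Set X} (hS : IsSplit H S) : IsSplit H Sᶜ := by
  intro σ hσ
  obtain ⟨h₁, τ, hτ, h₂, h₃⟩ := hS σ hσ
  refine ⟨fun x => not_congr (h₁ x), σ * τ⁻¹, H.mul_mem hσ (H.inv_mem hτ), fun x hx => ?_,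
    fun x hx => ?_⟩
  · have : τ⁻¹ x = x := by rw [Perm.inv_eq_iff_eq, h₃ x hx]
    rw [Perm.mul_apply, this]
  · rw [Set.notMem_compl_iff] at hx
    obtain ⟨y, rfl⟩ := σ.surjective x
    rw [h₁] at hx
    have : τ⁻¹ (σ y) = y := by rw [Perm.inv_eq_iff_eq, h₂ y hx]
    rw [Perm.mul_apply, this]

theorem IsSplit.inter {S T : Set X} (hS : IsSplit H S) (hT : IsSplit H T) :
    IsSplit H (S ∩ T) := by
  intro σ hσ
  obtain ⟨h₁, τ, hτ, h₂, h₃⟩ := hS σ hσ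
  obtain ⟨h₄, -⟩ := hT σ hσ
  obtain ⟨-, ρ, hρ, h₅, h₆⟩ := hT τ hτ
  refine ⟨fun x => and_congr (h₁ x) (h₄ x), ρ, hρ, fun x hx => ?_, fun x hx => ?_⟩
  · rw [h₅ x hx.2, h₂ x hx.1]
  · by_cases hxT : x ∈ T
    · rw [h₅ x hxT, h₃ x fun hxS => hx ⟨hxS, hxT⟩]
    · exact h₆ x hxT

theorem IsSplit.exists_subtypePerm_mem {p : X → Prop} [DecidablePred p]
    (h : IsSplit H {x | p x}) {σ : Perm X} (hσ : σ ∈ H) :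
    ∃ h₁ : ∀ x, p (σ x) ↔ p x, σ.subtypePerm h₁ ∈ H.comap Perm.ofSubtype := by
  obtain ⟨h₁, ρ, hρ, h₂, h₃⟩ := h σ hσ
  refine ⟨h₁, ?_⟩
  rw [Subgroup.mem_comap]
  convert hρ
  ext x
  by_cases hx : p x
  · rw [Perm.ofSubtype_apply_of_mem _ hx, h₂ x hx]
    rfl
  · rw [Perm.ofSubtype_apply_of_not_mem _ hx, h₃ x hx]

theorem isSplit_sInter [Finite X] {A : Set (Set X)} (hA : ∀ S ∈ A, IsSplit H S) :
    IsSplit H (⋂₀ A) := by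
  induction A, A.toFinite using Set.Finite.induction_on with
  | empty => simpa using isSplit_univ
  | insert _ _ ih =>
    rw [Set.sInter_insert]
    exact (hA _ (Set.mem_insert _ _)).inter (ih fun S hS => hA S (Set.mem_insert_of_mem _ hS))

theorem isConnectedSubgroup_iff :
    IsConnectedSubgroup H ↔ Nonempty X ∧ ∀ S, IsSplit H S → S = ∅ ∨ S = Set.univ := by
  constructor
  · intro h
    constructor
    · by_contra hX
      rw [not_nonempty_iff] at hX
      have := h ∅ ⟨⟨by simp, fun a => isEmptyElim a⟩, by simp, by simp⟩
      simp at this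
    · intro S hS
      by_contra! hne
      have himage : ∀ T : Set X, IsSplit H T → ∀ σ ∈ H, σ '' T = T := by
        intro T hT σ hσ
        ext y
        obtain ⟨x, rfl⟩ := σ.surjective y
        rw [σ.injective.mem_set_image, (hT σ hσ).1]
      have := h {S, Sᶜ} ⟨⟨?_, fun a => ?_⟩, ?_, ?_⟩
      · have hmem : S ∈ ({Set.univ} : Set (Set X)) := this ▸ Set.mem_insert _ _
        exact hne.2 hmem
      · rintro (h | h)
        · exact hne.1.ne_empty h.symm
        · exact hne.2 (Set.compl_empty_iff.1 (Eq.symm h))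
      · by_cases ha : a ∈ S
        · refine ⟨S, ⟨Or.inl rfl, ha⟩, ?_⟩
          rintro T ⟨rfl | rfl, hT⟩
          · rfl
          · exact absurd ha hT
        · refine ⟨Sᶜ, ⟨Or.inr rfl, ha⟩, ?_⟩
          rintro T ⟨rfl | rfl, hT⟩
          · exact absurd hT ha
          · rfl
      · rintro σ hσ Y (rfl | rfl)
        · exact himage _ hS σ hσ
        · exact himage _ hS.compl σ hσ
      · rintro σ hσ Y (rfl | rfl)
        · exact (hS σ hσ).2
        · exact (hS.compl σ hσ).2
  · rintro ⟨⟨x⟩, h⟩ P ⟨⟨hP, hP'⟩, hinv, hres⟩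
    have huniv : ∀ Y ∈ P, Y = Set.univ := by
      intro Y hY
      refine (h Y fun σ hσ => ⟨fun x => ?_, hres σ hσ Y hY⟩).resolve_left fun h => hP (h ▸ hY)
      conv_lhs => rw [← hinv σ hσ Y hY]
      exact σ.injective.mem_set_image
    obtain ⟨Y, ⟨hY, -⟩, -⟩ := hP' x
    refine Set.Subset.antisymm huniv ?_
    rintro _ rfl
    exact huniv Y hY ▸ hY

theorem IsSplit.image {e : X ≃ Y}
    (he : ∀ (σ : Perm X) (τ : Perm Y), (∀ x, e (σ x) = τ (e x)) → (σ ∈ H ↔ τ ∈ K))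
    {S : Set X} (hS : IsSplit H S) : IsSplit K (e '' S) := by
  intro σ hσ
  obtain ⟨h₁, τ, hτ, h₂, h₃⟩ := hS (e.symm.permCongr σ) ((he _ σ (by simp)).2 hσ)
  refine ⟨fun y => ?_, e.permCongr τ, (he τ _ (by simp)).1 hτ, ?_, fun y hy => ?_⟩
  · obtain ⟨x, rfl⟩ := e.surjective y
    have := h₁ x
    rw [← e.injective.mem_set_image] at this
    simpa using this
  · rintro _ ⟨x, hx, rfl⟩
    simp [h₂ x hx]
  · obtain ⟨x, rfl⟩ := e.surjective y
    rw [e.injective.mem_set_image] at hy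
    simp [h₃ x hy]

theorem PermIso.isConnectedSubgroup (h : PermIso H K) (hH : IsConnectedSubgroup H) :
    IsConnectedSubgroup K := by
  rw [isConnectedSubgroup_iff] at hH ⊢
  obtain ⟨e, he⟩ := h.symm
  refine ⟨hH.1.map e.symm, fun S hS => ?_⟩
  refine (hH.2 _ (hS.image he)).imp (fun h => ?_) fun h => ?_
  · simpa using h
  · rw [← e.preimage_image S, h, Set.preimage_univ]

end IsSplit

section prodSub

variable {ι ι' : Type*} {X : ι → Type*} {X' : ι' → Type*}

theorem mem_prodSub {G : ∀ j, Subgroup (Perm (X j))} {σ : Perm (Σ j, X j)} :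
    σ ∈ prodSub G ↔ ∀ j, ∃ f ∈ G j, ∀ a, σ ⟨j, a⟩ = ⟨j, f a⟩ := by
  constructor
  · rintro ⟨f, hf, rfl⟩ j
    exact ⟨f j, hf j (Set.mem_univ j), fun a => rfl⟩
  · intro h
    choose f hf hσ using h
    exact ⟨f, fun j _ => hf j, Equiv.ext fun ⟨j, a⟩ => (hσ j a).symm⟩

theorem sigmaCongrRight_mulSingle_mem_prodSub [DecidableEq ι] {G : ∀ j, Subgroup (Perm (X j))}
    {j : ι} {f : Perm (X j)} :
    Perm.sigmaCongrRightHom X (Pi.mulSingle j f) ∈ prodSub G ↔ f ∈ G j := by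
  rw [prodSub, Subgroup.mem_map_iff_mem Perm.sigmaCongrRightHom_injective,
    Subgroup.mulSingle_mem_pi]
  simp

theorem permIso_prodSub {G : ∀ j, Subgroup (Perm (X j))} {G' : ∀ j, Subgroup (Perm (X' j))}
    (φ : ι ≃ ι') (h : ∀ j, PermIso (G j) (G' (φ j))) : PermIso (prodSub G) (prodSub G') := by
  choose e he using h
  refine ⟨Equiv.sigmaCongr φ e, fun σ τ h => ?_⟩
  rw [mem_prodSub, mem_prodSub]
  constructor
  · intro hσ k
    obtain ⟨j, rfl⟩ := φ.surjective k
    obtain ⟨f, hf, hfσ⟩ := hσ j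
    refine ⟨(e j).permCongr f, (he j f _ (by simp)).1 hf, fun b => ?_⟩
    obtain ⟨a, rfl⟩ := (e j).surjective b
    have := h ⟨j, a⟩
    rw [hfσ] at this
    simpa [Equiv.sigmaCongr] using this.symm
  · intro hτ j
    obtain ⟨f, hf, hfτ⟩ := hτ (φ j)
    refine ⟨(e j).symm.permCongr f, (he j _ f (by simp)).2 hf, fun a => ?_⟩
    apply (Equiv.sigmaCongr φ e).injective
    rw [h]
    simpa [Equiv.sigmaCongr] using hfτ (e j a)

theorem isSplit_fiber (G : ∀ j, Subgroup (Perm (X j))) (j : ι) :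
    IsSplit (prodSub G) {p | p.1 = j} := by
  classical
  rintro _ ⟨f, hf, rfl⟩
  refine ⟨fun x => Iff.rfl, _,
    sigmaCongrRight_mulSingle_mem_prodSub.2 (hf j (Set.mem_univ j)), ?_, ?_⟩
  · rintro ⟨_, a⟩ rfl
    simp [Perm.sigmaCongrRightHom]
  · rintro ⟨k, a⟩ (hk : k ≠ j)
    simp [Perm.sigmaCongrRightHom, hk]

theorem IsSplit.preimage_mk {G : ∀ j, Subgroup (Perm (X j))} {S : Set (Σ j, X j)}
    (hS : IsSplit (prodSub G) S) (j : ι) : IsSplit (G j) (Sigma.mk j ⁻¹' S) := by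
  classical
  intro σ hσ
  obtain ⟨h₁, τ, hτ, h₂, h₃⟩ := hS _ (sigmaCongrRight_mulSingle_mem_prodSub.2 hσ)
  obtain ⟨f, hf, hfτ⟩ := mem_prodSub.1 hτ j
  refine ⟨fun a => ?_, f, hf, fun a ha => ?_, fun a ha => ?_⟩
  · simpa [Perm.sigmaCongrRightHom] using h₁ ⟨j, a⟩
  · simpa [Perm.sigmaCongrRightHom, hfτ] using h₂ ⟨j, a⟩ ha
  · simpa [hfτ] using h₃ ⟨j, a⟩ ha

/-- Points of a product of connected groups lie in the same factor iff no split set separates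
them. -/
theorem fst_eq_iff_forall_isSplit {G : ∀ j, Subgroup (Perm (X j))}
    (hG : ∀ j, IsConnectedSubgroup (G j)) {x y : Σ j, X j} :
    x.1 = y.1 ↔ ∀ S, IsSplit (prodSub G) S → x ∈ S → y ∈ S := by
  constructor
  · obtain ⟨j, a⟩ := x
    obtain ⟨k, b⟩ := y
    rintro (rfl : j = k) S hS hx
    rcases (isConnectedSubgroup_iff.1 (hG j)).2 _ (hS.preimage_mk j) with h | h
    · exact absurd (show a ∈ Sigma.mk j ⁻¹' S from hx) (by simp [h])
    · exact show b ∈ Sigma.mk j ⁻¹' S by simp [h]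
  · intro h
    exact (h _ (isSplit_fiber G x.1) rfl).symm

theorem exists_equiv_of_permIso_prodSub {G : ∀ j, Subgroup (Perm (X j))}
    {G' : ∀ j, Subgroup (Perm (X' j))} (hG : ∀ j, IsConnectedSubgroup (G j))
    (hG' : ∀ j, IsConnectedSubgroup (G' j)) (h : PermIso (prodSub G) (prodSub G')) :
    ∃ φ : ι ≃ ι', ∀ j, PermIso (G j) (G' (φ j)) := by
  classical
  obtain ⟨e, he⟩ := h
  have he' : ∀ (σ : Perm (Σ j, X' j)) (τ : Perm (Σ j, X j)),
      (∀ x, e.symm (σ x) = τ (e.symm x)) → (σ ∈ prodSub G' ↔ τ ∈ prodSub G) := by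
    refine fun σ τ h => (he τ σ fun x => ?_).symm
    rw [← e.apply_symm_apply (σ (e x)), h, e.symm_apply_apply]
  have hfst : ∀ x y, (e x).1 = (e y).1 ↔ x.1 = y.1 := by
    intro x y
    rw [fst_eq_iff_forall_isSplit hG, fst_eq_iff_forall_isSplit hG']
    constructor
    · intro h S hS hx
      exact (e.injective.mem_set_image).1 (h _ (hS.image he) (Set.mem_image_of_mem e hx))
    · intro h S hS hx
      have := h _ (hS.image he')
      simpa [hx, Equiv.image_symm_eq_preimage] using this
  have hne : ∀ j, Nonempty (X j) := fun j => (isConnectedSubgroup_iff.1 (hG j)).1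
  have hne' : ∀ j, Nonempty (X' j) := fun j => (isConnectedSubgroup_iff.1 (hG' j)).1
  let φ₀ : ι → ι' := fun j => (e ⟨j, (hne j).some⟩).1
  have hφ₀ : ∀ x, (e x).1 = φ₀ x.1 := fun x => (hfst _ _).2 rfl
  have hbij : Function.Bijective φ₀ := by
    refine ⟨fun j k h => (hfst _ _).1 h, fun k => ?_⟩
    obtain ⟨x, hx⟩ := e.surjective ⟨k, (hne' k).some⟩
    exact ⟨x.1, by rw [← hφ₀, hx]⟩
  refine ⟨Equiv.ofBijective φ₀ hbij, fun j => ?_⟩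
  change PermIso (G j) (G' (φ₀ j))
  have hmk : ∀ a, ∃ b, e ⟨j, a⟩ = ⟨φ₀ j, b⟩ := by
    intro a
    have := hφ₀ ⟨j, a⟩
    generalize e ⟨j, a⟩ = z at this
    obtain ⟨k, b⟩ := z
    obtain rfl : k = φ₀ j := this
    exact ⟨b, rfl⟩
  choose f hf using hmk
  have hfbij : Function.Bijective f := by
    constructor
    · intro a b hab
      have : e ⟨j, a⟩ = e ⟨j, b⟩ := by rw [hf, hf, hab]
      simpa using this
    · intro b
      obtain ⟨⟨k, a⟩, hx⟩ := e.surjective ⟨φ₀ j, b⟩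
      have hk : φ₀ k = φ₀ j := by rw [← hφ₀ ⟨k, a⟩, hx]
      obtain rfl := hbij.1 hk
      refine ⟨a, ?_⟩
      rw [hf] at hx
      simpa using hx
  refine ⟨Equiv.ofBijective f hfbij, fun σ τ h => ?_⟩
  rw [← sigmaCongrRight_mulSingle_mem_prodSub (G := G),
    ← sigmaCongrRight_mulSingle_mem_prodSub (G := G')]
  apply he
  rintro ⟨k, a⟩
  by_cases hk : k = j
  · subst hk
    have := h a
    simp only [Equiv.ofBijective_apply] at this
    simp [Perm.sigmaCongrRightHom, hf, this]
  · have h₁ : (e ⟨k, a⟩).1 ≠ φ₀ j := fun h => hk (hbij.1 (by rw [← hφ₀ ⟨k, a⟩, h]))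
    generalize hz : e ⟨k, a⟩ = z at h₁
    obtain ⟨l, b⟩ := z
    simp only at h₁
    simp [Perm.sigmaCongrRightHom, hk, h₁, hz]

/-- A group for which all fibers of `q` are split is the product of its restrictions to them. -/
theorem permIso_prodSub_of_isSplit {X : Type*} [Finite ι] {H : Subgroup (Perm X)} (q : X → ι)
    [DecidableEq ι] (h : ∀ j, IsSplit H {x | q x = j}) :
    PermIso H (prodSub fun j => H.comap (Perm.ofSubtype : Perm {x // q x = j} →* Perm X)) := by
  refine ⟨(Equiv.sigmaFiberEquiv q).symm, fun σ τ hστ => ?_⟩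
  have hστ' : ∀ y, (Equiv.sigmaFiberEquiv q) (τ y) = σ (Equiv.sigmaFiberEquiv q y) := by
    intro y
    rw [← Equiv.eq_symm_apply, hστ, Equiv.symm_apply_apply]
  constructor
  · intro hσ
    rw [mem_prodSub]
    intro j
    obtain ⟨h₁, h₂⟩ := (h j).exists_subtypePerm_mem hσ
    refine ⟨σ.subtypePerm h₁, h₂, fun a => ?_⟩
    apply (Equiv.sigmaFiberEquiv q).injective
    rw [hστ']
    rfl
  · rintro ⟨f, hf, rfl⟩
    have key : f ∈ (H.comap (Equiv.sigmaFiberEquiv q).permCongrHom.toMonoidHom).comap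
        (Perm.sigmaCongrRightHom _) := by
      refine Subgroup.pi_mem_of_mulSingle_mem f fun j => ?_
      rw [Subgroup.mem_comap, Subgroup.mem_comap]
      refine (congrArg (· ∈ H) ?_).mpr (hf j (Set.mem_univ j))
      ext x
      obtain ⟨⟨k, x, rfl⟩, rfl⟩ := (Equiv.sigmaFiberEquiv q).surjective x
      by_cases hk : q x = j
      · subst hk
        simp [Perm.sigmaCongrRightHom, Equiv.sigmaFiberEquiv, Perm.ofSubtype_apply_of_mem]
      · simp [Perm.sigmaCongrRightHom, Equiv.sigmaFiberEquiv, Perm.ofSubtype_apply_of_not_mem, hk]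
    rw [Subgroup.mem_comap, Subgroup.mem_comap] at key
    convert key
    ext x
    obtain ⟨y, rfl⟩ := (Equiv.sigmaFiberEquiv q).surjective x
    change _ = Equiv.sigmaFiberEquiv q (Perm.sigmaCongrRightHom _ f
      ((Equiv.sigmaFiberEquiv q).symm (Equiv.sigmaFiberEquiv q y)))
    rw [← hστ', Equiv.symm_apply_apply]

/-- Every permutation group of a finite set is a product of connected ones. -/
theorem exists_permIso_prodSub {X : Type} [Finite X] (H : Subgroup (Perm X)) :
    ∃ (ι : Type) (_ : Fintype ι) (Y : ι → Type) (_ : ∀ j, Finite (Y j))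
      (G : ∀ j, Subgroup (Perm (Y j))),
      (∀ j, IsConnectedSubgroup (G j)) ∧ PermIso H (prodSub G) := by
  classical
  let r : Setoid X :=
    ⟨fun x y => ∀ S, IsSplit H S → (x ∈ S ↔ y ∈ S), fun _ _ _ => Iff.rfl,
      fun h S hS => (h S hS).symm, fun h h' S hS => (h S hS).trans (h' S hS)⟩
  let q : X → Quotient r := Quotient.mk r
  have hq : ∀ x y, q x = q y ↔ ∀ S, IsSplit H S → (x ∈ S ↔ y ∈ S) :=
    fun x y => Quotient.eq (r := r)
  have hsplit : ∀ j, IsSplit H {x | q x = j} := by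
    intro j
    obtain ⟨y, rfl⟩ := Quotient.exists_rep j
    have : {x | q x = q y} = ⋂₀ {S | IsSplit H S ∧ y ∈ S} := by
      ext x
      rw [Set.mem_ofPred_eq, hq]
      constructor
      · rintro h S ⟨hS, hy⟩
        exact (h S hS).2 hy
      · intro h S hS
        refine ⟨fun hx => ?_, fun hy => h S ⟨hS, hy⟩⟩
        by_contra hy
        exact h Sᶜ ⟨hS.compl, hy⟩ hx
    change IsSplit H {x | q x = q y}
    rw [this]
    exact isSplit_sInter fun S hS => hS.1
  refine ⟨Quotient r, Fintype.ofFinite _, fun j => {x // q x = j}, fun j => inferInstance,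
    fun j => H.comap Perm.ofSubtype, fun j => ?_, permIso_prodSub_of_isSplit q hsplit⟩
  rw [isConnectedSubgroup_iff]
  constructor
  · obtain ⟨y, rfl⟩ := Quotient.exists_rep j
    exact ⟨y, rfl⟩
  · intro S hS
    have himage : IsSplit H (Subtype.val '' S) := by
      intro σ hσ
      obtain ⟨h₁, hmem⟩ := (hsplit j).exists_subtypePerm_mem hσ
      obtain ⟨h₄, τ, hτ, h₅, h₆⟩ := hS _ hmem
      refine ⟨fun x => ?_, Perm.ofSubtype τ, hτ, ?_, fun x hx => ?_⟩
      · by_cases hx : q x = j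
        · have := h₄ ⟨x, hx⟩
          simp only [Perm.subtypePerm_apply] at this
          have hx' : q (σ x) = j := (h₁ x).2 hx
          simpa [hx, hx'] using this
        · have hx' : ¬ q (σ x) = j := fun h => hx ((h₁ x).1 h)
          simp [hx, hx']
      · rintro _ ⟨x, hx, rfl⟩
        rw [Perm.ofSubtype_apply_coe, h₅ x hx]
        rfl
      · by_cases hxj : q x = j
        · rw [Perm.ofSubtype_apply_of_mem (p := fun x => q x = j) _ hxj,
            h₆ ⟨x, hxj⟩ fun h => hx ⟨_, h, rfl⟩]
        · exact Perm.ofSubtype_apply_of_not_mem (p := fun x => q x = j) _ hxj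
    rw [or_iff_not_imp_left, ← ne_eq, ← Set.nonempty_iff_ne_empty]
    rintro ⟨x, hx⟩
    refine Set.eq_univ_of_forall fun y => ?_
    have := ((hq x.1 y.1).1 (x.2.trans y.2.symm) _ himage).1 ⟨x, hx, rfl⟩
    simpa [y.2] using this

end prodSub

section ConnClass

/-- The conjugacy classes of connected subgroups of `Sym(Fin i)`. -/
abbrev ConnClass (i : ℕ) : Type :=
  Quot (fun (H K : {H : Subgroup (Perm (Fin i)) // IsConnectedSubgroup H}) =>
    ∃ g, K.1 = conjSub g H.1)

/-- A representative of a class of connected subgroups. -/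
noncomputable def classRep (d : Σ i, ConnClass i) : Subgroup (Perm (Fin d.1)) :=
  (Quot.out d.2).1

theorem isConnectedSubgroup_classRep (d : Σ i, ConnClass i) : IsConnectedSubgroup (classRep d) :=
  (Quot.out d.2).2

theorem eq_of_permIso_classRep {d d' : Σ i, ConnClass i}
    (h : PermIso (classRep d) (classRep d')) : d = d' := by
  obtain ⟨i, c⟩ := d
  obtain ⟨i', c'⟩ := d'
  obtain rfl : i = i' := by simpa using h.natCard_eq
  rw [← Quot.out_eq c, ← Quot.out_eq c']
  exact congrArg (Sigma.mk i) (Quot.sound (permIso_iff_conjSub.1 h))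

theorem exists_permIso_classRep {X : Type*} [Finite X] {H : Subgroup (Perm X)}
    (hH : IsConnectedSubgroup H) : ∃ d, PermIso H (classRep d) := by
  have hK := permIso_map H (Finite.equivFin X)
  refine ⟨⟨Nat.card X, Quot.mk _ ⟨_, hK.isConnectedSubgroup hH⟩⟩, hK.trans ?_⟩
  have heq : Equivalence fun (H K : {H : Subgroup (Perm (Fin (Nat.card X))) //
      IsConnectedSubgroup H}) => ∃ g, K.1 = conjSub g H.1 :=
    equivalence_conjSub.comap Subtype.val
  exact permIso_iff_conjSub.2 ((heq.quot_mk_eq_iff _ _).1 (Quot.out_eq _).symm)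

theorem isEmpty_connClass_zero : IsEmpty (ConnClass 0) := by
  refine ⟨fun c => ?_⟩
  obtain ⟨x⟩ := (isConnectedSubgroup_iff.1 (Quot.out c).2).1
  exact x.elim0

theorem exists_equiv_of_map_univ_eq {ι ι' α : Type*} [Fintype ι] [Fintype ι'] {d : ι → α}
    {d' : ι' → α} (h : Finset.univ.val.map d = Finset.univ.val.map d') :
    ∃ φ : ι ≃ ι', ∀ j, d' (φ j) = d j := by
  classical
  have hcard : ∀ a, Nonempty ({j // d j = a} ≃ {j // d' j = a}) := by
    intro a
    rw [← Fintype.card_eq, Fintype.card_subtype, Fintype.card_subtype]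
    have := congrArg (Multiset.count a) h
    rw [Multiset.count_map, Multiset.count_map] at this
    simpa [Finset.card_def, eq_comm] using this
  exact ⟨Equiv.ofFiberEquiv fun a => (hcard a).some, Equiv.ofFiberEquiv_map _⟩

/-- Conjugacy classes of subgroups correspond to multisets of classes of connected subgroups. -/
theorem natCard_quot_eq (n : ℕ) :
    Nat.card (Quot (fun (H K : Subgroup (Perm (Fin n))) => ∃ g, K = conjSub g H)) =
      Nat.card {m : Multiset (Σ i, ConnClass i) // (m.map Sigma.fst).sum = n} := by
  classical
  have hrep : ∀ m : {m : Multiset (Σ i, ConnClass i) // (m.map Sigma.fst).sum = n},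
      ∃ H : Subgroup (Perm (Fin n)),
        PermIso H (prodSub fun x : m.1.ToType => classRep x.1) := by
    rintro ⟨m, hm⟩
    have e : (Σ x : m.ToType, Fin (x.1 : Σ i, ConnClass i).1) ≃ Fin n := by
      refine Fintype.equivFinOfCardEq ?_
      rw [Fintype.card_sigma, ← hm]
      conv_rhs => rw [← Multiset.map_univ_coe m, Multiset.map_map]
      simp [Finset.sum]
    exact ⟨_, (permIso_map _ e).symm⟩
  choose F hF using hrep
  refine (Nat.card_congr (Equiv.ofBijective (fun m => Quot.mk _ (F m)) ⟨?_, ?_⟩)).symm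
  · intro m m' h
    have h₁ := permIso_iff_conjSub.2 ((equivalence_conjSub.quot_mk_eq_iff _ _).1 h)
    obtain ⟨φ, hφ⟩ := exists_equiv_of_permIso_prodSub
      (fun _ => isConnectedSubgroup_classRep _) (fun _ => isConnectedSubgroup_classRep _)
      ((hF m).symm.trans (h₁.trans (hF m')))
    apply Subtype.ext
    rw [← Multiset.map_univ_coe m.1, ← Multiset.map_univ_coe m'.1,
      ← Multiset.map_univ_val_equiv φ, Multiset.map_map]
    exact Multiset.map_congr rfl fun j _ => eq_of_permIso_classRep (hφ j)
  · intro c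
    obtain ⟨H, rfl⟩ := Quot.exists_rep c
    obtain ⟨ι, _, Y, _, G, hG, hHG⟩ := exists_permIso_prodSub H
    choose d hd using fun j => exists_permIso_classRep (hG j)
    have hH : PermIso H (prodSub fun j => classRep (d j)) :=
      hHG.trans (permIso_prodSub (Equiv.refl ι) hd)
    have hsum : ((Finset.univ.val.map d).map Sigma.fst).sum = n := by
      have := hH.natCard_eq
      rw [Nat.card_fin, Nat.card_sigma] at this
      rw [Multiset.map_map, this, Finset.sum]
      exact congrArg Multiset.sum (Multiset.map_congr rfl fun j _ => (Nat.card_fin _).symm)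
    let m : {m : Multiset (Σ i, ConnClass i) // (m.map Sigma.fst).sum = n} := ⟨_, hsum⟩
    obtain ⟨φ, hφ⟩ := exists_equiv_of_map_univ_eq (Multiset.map_univ_coe m.1)
    refine ⟨m, Quot.sound (permIso_iff_conjSub.1 ((hF m).trans (PermIso.trans ?_ hH.symm)))⟩
    refine permIso_prodSub φ fun j => ?_
    rw [hφ j]
    exact PermIso.refl _

end ConnClass

section Counting

variable {c : ℕ → Type*}

/-- The elements of a multiset lying over the index `i`. -/
def part (i : ℕ) (m : Multiset (Σ i, c i)) : Multiset (c i) :=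
  m.filterMap fun d => if h : d.1 = i then some (h ▸ d.2) else none

@[simp]
theorem part_zero (i : ℕ) : part i (0 : Multiset (Σ i, c i)) = 0 := rfl

theorem part_cons_self (i : ℕ) (x : c i) (m : Multiset (Σ i, c i)) :
    part i (⟨i, x⟩ ::ₘ m) = x ::ₘ part i m :=
  Multiset.filterMap_cons_some _ _ _ (by simp)

theorem part_cons_of_ne {i j : ℕ} (h : i ≠ j) (x : c i) (m : Multiset (Σ i, c i)) :
    part j (⟨i, x⟩ ::ₘ m) = part j m :=
  Multiset.filterMap_cons_none _ _ (by simp [h])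

theorem part_add (i : ℕ) (m m' : Multiset (Σ i, c i)) : part i (m + m') = part i m + part i m' :=
  Multiset.filterMap_add _ _ _

theorem part_sum {ι : Type*} (i : ℕ) (s : Finset ι) (f : ι → Multiset (Σ i, c i)) :
    part i (∑ k ∈ s, f k) = ∑ k ∈ s, part i (f k) :=
  map_sum (⟨⟨part i, part_zero i⟩, part_add i⟩ : Multiset (Σ i, c i) →+ Multiset (c i)) f s

theorem part_map_mk_self (i : ℕ) (t : Multiset (c i)) : part i (t.map (Sigma.mk i)) = t := by
  induction t using Multiset.induction_on with
  | empty => rfl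
  | cons x t ih => rw [Multiset.map_cons, part_cons_self, ih]

theorem part_map_mk_of_ne {i j : ℕ} (h : i ≠ j) (t : Multiset (c i)) :
    part j (t.map (Sigma.mk i)) = 0 := by
  induction t using Multiset.induction_on with
  | empty => rfl
  | cons x t ih => rw [Multiset.map_cons, part_cons_of_ne h, ih]

theorem card_part (i : ℕ) (m : Multiset (Σ i, c i)) :
    (part i m).card = (m.map Sigma.fst).count i := by
  induction m using Multiset.induction_on with
  | empty => rfl
  | cons d m ih =>
    obtain ⟨j, x⟩ := d
    by_cases h : j = i
    · subst h
      simp [part_cons_self, ih]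
    · simp [part_cons_of_ne h, ih, Ne.symm h]

theorem sum_map_mk_part (s : Finset ℕ) (m : Multiset (Σ i, c i)) (hm : ∀ d ∈ m, d.1 ∈ s) :
    ∑ i ∈ s, (part i m).map (Sigma.mk i) = m := by
  induction m using Multiset.induction_on with
  | empty => simp
  | cons d m ih =>
    obtain ⟨j, x⟩ := d
    have hj : j ∈ s := hm _ (Multiset.mem_cons_self _ _)
    have ih' := ih fun d hd => hm d (Multiset.mem_cons_of_mem hd)
    rw [← Finset.add_sum_erase _ _ hj] at ih' ⊢
    rw [part_cons_self, Multiset.map_cons, Multiset.cons_add]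
    conv_rhs => rw [← ih']
    congr 2
    refine Finset.sum_congr rfl fun i hi => ?_
    rw [part_cons_of_ne (Finset.ne_of_mem_erase hi).symm]

theorem nonempty_equiv_sym (s : Finset ℕ) (p : Multiset ℕ) (hp : ∀ i ∈ p, i ∈ s) :
    Nonempty ({m : Multiset (Σ i, c i) // m.map Sigma.fst = p} ≃
      ∀ i : s, Sym (c i) (p.count (i : ℕ))) := by
  have hpart : ∀ (g : ∀ i : s, Sym (c i) (p.count (i : ℕ))) (i : s),
      part i (∑ k : s, (g k).1.map (Sigma.mk (k : ℕ))) = (g i).1 := by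
    intro g i
    rw [part_sum, Finset.sum_eq_single_of_mem i (Finset.mem_univ i), part_map_mk_self]
    exact fun k _ hk => part_map_mk_of_ne (fun h => hk (Subtype.ext h)) _
  exact ⟨
    { toFun := fun m i => ⟨part i m.1, by rw [card_part, m.2]⟩
      invFun := fun g => ⟨∑ k : s, (g k).1.map (Sigma.mk (k : ℕ)), by
        ext i
        rw [← card_part]
        by_cases hi : i ∈ s
        · rw [hpart g ⟨i, hi⟩]
          exact (g ⟨i, hi⟩).2
        · rw [part_sum, Finset.sum_eq_zero, Multiset.card_zero,
            Multiset.count_eq_zero_of_notMem fun h => hi (hp i h)]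
          exact fun k _ => part_map_mk_of_ne (fun h => hi (by rw [← h]; exact k.2)) _⟩
      left_inv := fun m => Subtype.ext <| by
        refine (Finset.sum_coe_sort s fun i => (part i m.1).map (Sigma.mk i)).trans ?_
        exact sum_map_mk_part s m.1 fun d hd => hp _ (m.2 ▸ Multiset.mem_map_of_mem _ hd)
      right_inv := fun g => funext fun i => Subtype.ext (hpart g i) }⟩

theorem natCard_multiset_map_fst_eq [∀ i, Finite (c i)] (s : Finset ℕ) (p : Multiset ℕ)
    (hp : ∀ i ∈ p, i ∈ s) :
    Finite {m : Multiset (Σ i, c i) // m.map Sigma.fst = p} ∧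
    Nat.card {m : Multiset (Σ i, c i) // m.map Sigma.fst = p} =
      ∏ i ∈ s, (Nat.card (c i)).multichoose (p.count i) := by
  classical
  have := fun i => Fintype.ofFinite (c i)
  obtain ⟨e⟩ := nonempty_equiv_sym (c := c) s p hp
  refine ⟨Finite.of_equiv _ e.symm, ?_⟩
  rw [Nat.card_congr e, Nat.card_pi, ← Finset.prod_coe_sort s]
  simp only [Nat.card_eq_fintype_card, Sym.card_sym_eq_multichoose]

theorem natCard_multiset_sum_eq [∀ i, Finite (c i)] [IsEmpty (c 0)] (n : ℕ) :
    Nat.card {m : Multiset (Σ i, c i) // (m.map Sigma.fst).sum = n} =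
      ∑ p : Nat.Partition n, ∏ i ∈ Finset.Icc 1 n,
        (Nat.card (c i)).multichoose (p.parts.count i) := by
  have hpos : ∀ (m : Multiset (Σ i, c i)) {i}, i ∈ m.map Sigma.fst → 0 < i := by
    intro m i hi
    obtain ⟨⟨j, x⟩, -, rfl⟩ := Multiset.mem_map.1 hi
    rcases j.eq_zero_or_pos with rfl | h
    · exact isEmptyElim x
    · exact h
  have hcard := fun p : Nat.Partition n => natCard_multiset_map_fst_eq (c := c)
    (Finset.Icc 1 n) p.parts fun i hi =>
      Finset.mem_Icc.2 ⟨p.parts_pos hi, p.parts_sum ▸ Multiset.le_sum_of_mem hi⟩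
  have := fun p => (hcard p).1
  have e : {m : Multiset (Σ i, c i) // (m.map Sigma.fst).sum = n} ≃
      Σ p : Nat.Partition n, {m : Multiset (Σ i, c i) // m.map Sigma.fst = p.parts} :=
    { toFun := fun m => ⟨⟨m.1.map Sigma.fst, hpos m.1, m.2⟩, m.1, rfl⟩
      invFun := fun x => ⟨x.2.1, by rw [x.2.2, x.1.parts_sum]⟩
      left_inv := fun m => rfl
      right_inv := by
        rintro ⟨p, m, hm⟩
        obtain ⟨q, h₁, h₂⟩ := p
        obtain rfl : _ = q := hm
        rfl }
  rw [Nat.card_congr e, Nat.card_sigma]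
  exact Finset.sum_congr rfl fun p _ => (hcard p).2

end Counting

end PermIsoClasses

theorem stmt19 (n : ℕ) (hn : 1 ≤ n) :
    Nat.card (Quot (fun (H K : Subgroup (Equiv.Perm (Fin n))) => ∃ g, K = conjSub g H)) =
      ∑ p : Nat.Partition n, ∏ i ∈ Finset.Icc 1 n,
        Nat.multichoose (conn i) (Multiset.count i p.parts) := by
  have := PermIsoClasses.isEmpty_connClass_zero
  rw [PermIsoClasses.natCard_quot_eq, PermIsoClasses.natCard_multiset_sum_eq]
  rfl
end
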